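/- For all n ≥ 2, the matrices L_{2^n} := B_{2^n}† M_{2^n} B_{2^n} satisfy the recursion L_{2^{n+1}} = σ_z ⊗ L_{2^n}. -/

import Mathlib

open Matrix Complex BigOperators

noncomputable section

/-- Cast a square complex matrix along an equality of sizes. -/
def matCast {a b : ℕ} (h : a = b) (A : Matrix (Fin a) (Fin a) ℂ) :
    Matrix (Fin b) (Fin b) ℂ :=
  Matrix.reindex (finCongr h) (finCongr h) A

/-- Kronecker product of square complex matrices, with indices flattened. -/
def kron {a b : ℕ} (A : Matrix (Fin a) (Fin a) ℂ) (B : Matrix (Fin b) (Fin b) ℂ) :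
    Matrix (Fin (a * b)) (Fin (a * b)) ℂ :=
  Matrix.reindex finProdFinEquiv finProdFinEquiv (Matrix.kroneckerMap (· * ·) A B)

/-- Kronecker product of (flattened) vectors. -/
def vkron {a b : ℕ} (u : Fin a → ℂ) (v : Fin b → ℂ) : Fin (a * b) → ℂ :=
  fun i => u (finProdFinEquiv.symm i).1 * v (finProdFinEquiv.symm i).2

/-- Cast a complex vector along an equality of sizes. -/
def vecCast {a b : ℕ} (h : a = b) (v : Fin a → ℂ) : Fin b → ℂ :=
  fun i => v ((finCongr h).symm i)

def σx : Matrix (Fin 2) (Fin 2) ℂ := !![0, 1; 1, 0]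
def σy : Matrix (Fin 2) (Fin 2) ℂ := !![0, -Complex.I; Complex.I, 0]
def σz : Matrix (Fin 2) (Fin 2) ℂ := !![1, 0; 0, -1]
def projL : Matrix (Fin 2) (Fin 2) ℂ := !![1, 0; 0, 0]
def projR : Matrix (Fin 2) (Fin 2) ℂ := !![0, 0; 0, 1]
def H2 : Matrix (Fin 2) (Fin 2) ℂ := (1 / (Real.sqrt 2 : ℂ)) • !![1, 1; 1, -1]

/-- `k`-fold Kronecker power of a 2×2 matrix. -/
def kpow (A : Matrix (Fin 2) (Fin 2) ℂ) : (k : ℕ) → Matrix (Fin (2 ^ k)) (Fin (2 ^ k)) ℂ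
  | 0 => 1
  | k + 1 => matCast (by rw [pow_succ, Nat.mul_comm]) (kron A (kpow A k))

/-- `M_{2^n} := σ_y ⊗ I_{2^{n-2}} ⊗ σ_y` (only meaningful for `n ≥ 2`). -/
def Mmat : (n : ℕ) → Matrix (Fin (2 ^ n)) (Fin (2 ^ n)) ℂ
  | 0 => 1
  | 1 => 1
  | m + 2 =>
      matCast (by ring)
        (kron σy (kron (1 : Matrix (Fin (2 ^ m)) (Fin (2 ^ m)) ℂ) σy))

/-- `F(ψ) = ⟨ψ| M_{2^n} K |ψ⟩ = Σ_{i,j} conj(ψ_i) (M_{2^n})_{ij} conj(ψ_j)`. -/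
def Fval (n : ℕ) (ψ : Fin (2 ^ n) → ℂ) : ℂ :=
  ∑ i, ∑ j, (starRingEnd ℂ) (ψ i) * Mmat n i j * (starRingEnd ℂ) (ψ j)

/-- generalized CNOT gate: `L ⊗ I_{2^{n-1}} + R ⊗ σ_x^{⊗(n-1)}`. -/
def CNOT : (n : ℕ) → Matrix (Fin (2 ^ n)) (Fin (2 ^ n)) ℂ
  | 0 => 1
  | m + 1 =>
      matCast (by rw [pow_succ, Nat.mul_comm])
        (kron projL (1 : Matrix (Fin (2 ^ m)) (Fin (2 ^ m)) ℂ)) +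
      matCast (by rw [pow_succ, Nat.mul_comm]) (kron projR (kpow σx m))

/-- Bell matrix: `B_{2^n} := CNOT_{2^n} (H_{2^{n-1}} ⊗ I₂)`. -/
def Bmat : (n : ℕ) → Matrix (Fin (2 ^ n)) (Fin (2 ^ n)) ℂ
  | 0 => 1
  | m + 1 =>
      CNOT (m + 1) *
        matCast (by rw [pow_succ]) (kron (kpow H2 m) (1 : Matrix (Fin 2) (Fin 2) ℂ))

/-- `L_{2^n} := B_{2^n}† M_{2^n} B_{2^n}`. -/
def Lmat (n : ℕ) : Matrix (Fin (2 ^ n)) (Fin (2 ^ n)) ℂ :=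
  (Bmat n)ᴴ * Mmat n * Bmat n

/-- The GHZ state `(1/√2)(|0…0⟩ + |1…1⟩)` as a vector in `ℂ^{2^n}`. -/
def GHZ (n : ℕ) : Fin (2 ^ n) → ℂ :=
  fun i => if (i : ℕ) = 0 ∨ (i : ℕ) = 2 ^ n - 1 then (1 / (Real.sqrt 2 : ℂ)) else 0

/-- A state `ψ : Fin (2^n) → ℂ`, viewed as a function `(Fin n → Fin 2) → ℂ`. -/
def toQubits {n : ℕ} (ψ : Fin (2 ^ n) → ℂ) : (Fin n → Fin 2) → ℂ :=
  fun f => ψ (finFunctionFinEquiv f)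

/-- Reduced density matrix of qubit `j` of the state `ψ`. -/
def rho {n : ℕ} (ψ : Fin (2 ^ n) → ℂ) (j : Fin n) : Matrix (Fin 2) (Fin 2) ℂ :=
  Matrix.of fun a b =>
    ∑ f : Fin n → Fin 2,
      if f j = 0 then
        toQubits ψ (Function.update f j a) * (starRingEnd ℂ) (toQubits ψ (Function.update f j b))
      else 0

/-- Meyer–Wallach measure `Q(ψ) = 2(1 - (1/n) Σ_j Tr[ρ_j²])`. -/
def Qmeasure {n : ℕ} (ψ : Fin (2 ^ n) → ℂ) : ℂ :=
  2 * (1 - (1 / (n : ℂ)) * ∑ j : Fin n, Matrix.trace (rho ψ j * rho ψ j))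

/-- The Thue–Morse sequence, specified by its recursion (1-indexed). -/
def IsThueMorse (τ : ℕ → ℕ) : Prop :=
  τ 1 = 0 ∧ (∀ n, 1 ≤ n → τ (2 * n) = 1 - τ n) ∧ (∀ n, 1 ≤ n → τ (2 * n - 1) = τ n)

theorem matCast_mul {a b : ℕ} (h : a = b) (A B : Matrix (Fin a) (Fin a) ℂ) :
    matCast h (A * B) = matCast h A * matCast h B := by
  subst h; rfl

theorem matCast_conjTranspose {a b : ℕ} (h : a = b) (A : Matrix (Fin a) (Fin a) ℂ) :
    (matCast h A)ᴴ = matCast h Aᴴ := by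
  subst h; rfl

theorem matCast_one {a b : ℕ} (h : a = b) :
    matCast h (1 : Matrix (Fin a) (Fin a) ℂ) = 1 := by
  subst h; rfl

theorem matCast_matCast {a b c : ℕ} (h : a = b) (h' : b = c) (A : Matrix (Fin a) (Fin a) ℂ) :
    matCast h' (matCast h A) = matCast (h.trans h') A := by
  subst h; subst h'; rfl

theorem kron_mul {a b : ℕ} (A A' : Matrix (Fin a) (Fin a) ℂ) (B B' : Matrix (Fin b) (Fin b) ℂ) :
    kron A B * kron A' B' = kron (A * A') (B * B') := by
  simp only [kron, Matrix.mul_kronecker_mul, Matrix.reindex_apply, Matrix.submatrix_mul_equiv]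

theorem kron_conjTranspose {a b : ℕ} (A : Matrix (Fin a) (Fin a) ℂ)
    (B : Matrix (Fin b) (Fin b) ℂ) : (kron A B)ᴴ = kron Aᴴ Bᴴ := by
  ext i j
  simp [kron]

theorem kron_one {a b : ℕ} :
    kron (1 : Matrix (Fin a) (Fin a) ℂ) (1 : Matrix (Fin b) (Fin b) ℂ) = 1 := by
  simp [kron]

theorem kron_matCast {a b c : ℕ} (h : b = c) (A : Matrix (Fin a) (Fin a) ℂ)
    (B : Matrix (Fin b) (Fin b) ℂ) :
    kron A (matCast h B) = matCast (congrArg (a * ·) h) (kron A B) := by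
  subst h; rfl

theorem matCast_kron {a b c : ℕ} (h : a = c) (A : Matrix (Fin a) (Fin a) ℂ)
    (B : Matrix (Fin b) (Fin b) ℂ) :
    kron (matCast h A) B = matCast (congrArg (· * b) h) (kron A B) := by
  subst h; rfl

theorem kron_assoc {a b c : ℕ} (A : Matrix (Fin a) (Fin a) ℂ) (B : Matrix (Fin b) (Fin b) ℂ)
    (C : Matrix (Fin c) (Fin c) ℂ) :
    kron (kron A B) C = matCast (Nat.mul_assoc a b c).symm (kron A (kron B C)) := by
  have key : ∀ i : Fin (a * b * c),
      finProdFinEquiv.symm ((finCongr (Nat.mul_assoc a b c)) i) =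
        ((finProdFinEquiv.symm (finProdFinEquiv.symm i).1).1,
          finProdFinEquiv ((finProdFinEquiv.symm (finProdFinEquiv.symm i).1).2,
            (finProdFinEquiv.symm i).2)) := by
    intro i
    obtain ⟨⟨p, z⟩, rfl⟩ := finProdFinEquiv.surjective i
    obtain ⟨⟨x, y⟩, rfl⟩ := finProdFinEquiv.surjective p
    rw [Equiv.symm_apply_eq]
    ext
    simp
    ring
  ext i j
  have hi := key i
  have hj := key j
  simp only [kron, matCast, Matrix.reindex_apply, Matrix.submatrix_apply,
    Matrix.kroneckerMap_apply, finCongr_symm] at hi hj ⊢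
  rw [hi, hj]
  simp [mul_assoc]

theorem kpow_mul (A B : Matrix (Fin 2) (Fin 2) ℂ) (k : ℕ) :
    kpow A k * kpow B k = kpow (A * B) k := by
  induction k with
  | zero => simp [kpow]
  | succ k ih => simp only [kpow, ← matCast_mul, kron_mul, ih]

theorem kpow_conjTranspose (A : Matrix (Fin 2) (Fin 2) ℂ) (k : ℕ) :
    (kpow A k)ᴴ = kpow Aᴴ k := by
  induction k with
  | zero => simp [kpow]
  | succ k ih => simp only [kpow, matCast_conjTranspose, kron_conjTranspose, ih]

theorem kron_one_left_cast {b : ℕ} (A : Matrix (Fin b) (Fin b) ℂ) :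
    kron (1 : Matrix (Fin 1) (Fin 1) ℂ) A = matCast (Nat.one_mul b).symm A := by
  ext i j
  obtain ⟨⟨x, y⟩, rfl⟩ := finProdFinEquiv.surjective i
  obtain ⟨⟨x', y'⟩, rfl⟩ := finProdFinEquiv.surjective j
  obtain rfl := Subsingleton.elim x 0
  obtain rfl := Subsingleton.elim x' 0
  simp only [kron, matCast, Matrix.reindex_apply, Matrix.submatrix_apply,
    Matrix.kroneckerMap_apply, Equiv.symm_apply_apply, Matrix.one_apply_eq, one_mul]
  congr 1

theorem kron_one_right_cast {a : ℕ} (A : Matrix (Fin a) (Fin a) ℂ) :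
    kron A (1 : Matrix (Fin 1) (Fin 1) ℂ) = matCast (Nat.mul_one a).symm A := by
  ext i j
  obtain ⟨⟨x, y⟩, rfl⟩ := finProdFinEquiv.surjective i
  obtain ⟨⟨x', y'⟩, rfl⟩ := finProdFinEquiv.surjective j
  obtain rfl := Subsingleton.elim y 0
  obtain rfl := Subsingleton.elim y' 0
  simp only [kron, matCast, Matrix.reindex_apply, Matrix.submatrix_apply,
    Matrix.kroneckerMap_apply, Equiv.symm_apply_apply, Matrix.one_apply_eq, mul_one]
  congr 1 <;> ext <;> simp

/-- A Kronecker power may also be extended on the right. -/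
theorem kpow_succ_right (A : Matrix (Fin 2) (Fin 2) ℂ) (k : ℕ) :
    kpow A (k + 1) = matCast (pow_succ 2 k).symm (kron (kpow A k) A) := by
  induction k with
  | zero =>
    change matCast _ (kron A (1 : Matrix (Fin 1) (Fin 1) ℂ)) =
      matCast _ (kron (1 : Matrix (Fin 1) (Fin 1) ℂ) A)
    simp only [kron_one_left_cast, kron_one_right_cast, matCast_matCast]
  | succ k ih =>
    conv_lhs => rw [kpow, ih]
    conv_rhs => rw [kpow]
    simp only [kron_matCast, matCast_kron, kron_assoc, matCast_matCast]

/-- The three-factor Kronecker product with a single qubit at either end. -/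
def kronEnds {m : ℕ} (A : Matrix (Fin 2) (Fin 2) ℂ) (B : Matrix (Fin (2 ^ m)) (Fin (2 ^ m)) ℂ)
    (C : Matrix (Fin 2) (Fin 2) ℂ) : Matrix (Fin (2 ^ (m + 2))) (Fin (2 ^ (m + 2))) ℂ :=
  matCast (by ring) (kron A (kron B C))

section kronEnds

variable {m : ℕ} (A A' C C' : Matrix (Fin 2) (Fin 2) ℂ)
  (B B' : Matrix (Fin (2 ^ m)) (Fin (2 ^ m)) ℂ)

theorem kronEnds_mul :
    kronEnds A B C * kronEnds A' B' C' = kronEnds (A * A') (B * B') (C * C') := by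
  simp only [kronEnds, ← matCast_mul, kron_mul]

theorem kronEnds_conjTranspose : (kronEnds A B C)ᴴ = kronEnds Aᴴ Bᴴ Cᴴ := by
  simp only [kronEnds, matCast_conjTranspose, kron_conjTranspose]

theorem kronEnds_zero_left : kronEnds 0 B C = 0 := by
  ext i j
  simp [kronEnds, matCast, kron]

theorem kronEnds_add_left : kronEnds (A + A') B C = kronEnds A B C + kronEnds A' B C := by
  ext i j
  simp [kronEnds, matCast, kron, add_mul]

theorem kronEnds_neg_left : kronEnds (-A) B C = -kronEnds A B C := by
  ext i j
  simp [kronEnds, matCast, kron]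

theorem kronEnds_smul_right (z : ℂ) : kronEnds A B (z • C) = kronEnds (z • A) B C := by
  ext i j
  simp [kronEnds, matCast, kron]
  ring

end kronEnds

theorem kpow_add_two (A : Matrix (Fin 2) (Fin 2) ℂ) (m : ℕ) :
    kpow A (m + 2) = kronEnds A (kpow A m) A := by
  rw [kpow, kpow_succ_right, kron_matCast, matCast_matCast, kronEnds]

theorem CNOT_add_two (m : ℕ) :
    CNOT (m + 2) = kronEnds projL 1 1 + kronEnds projR (kpow σx m) σx := by
  rw [CNOT, kpow_succ_right, kron_matCast, matCast_matCast, kronEnds, kronEnds, kron_one,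
    ← matCast_one (pow_succ 2 m).symm, kron_matCast, matCast_matCast]

theorem Bmat_add_two (m : ℕ) :
    Bmat (m + 2) =
      kronEnds (projL * H2) (kpow H2 m) 1 + kronEnds (projR * H2) (kpow (σx * H2) m) σx := by
  have h : matCast (pow_succ 2 (m + 1)).symm (kron (kpow H2 (m + 1)) (1 : Matrix (Fin 2) (Fin 2) ℂ)) =
      kronEnds H2 (kpow H2 m) 1 := by
    rw [kpow, matCast_kron, kron_assoc, matCast_matCast, matCast_matCast, kronEnds]
  rw [Bmat, h, CNOT_add_two, add_mul, kronEnds_mul, kronEnds_mul, kpow_mul, one_mul, one_mul,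
    mul_one]

theorem inv_sqrt_two_mul_self :
    ((Real.sqrt 2 : ℂ))⁻¹ * ((Real.sqrt 2 : ℂ))⁻¹ = 1 / 2 := by
  rw [← mul_inv, ← Complex.ofReal_mul, Real.mul_self_sqrt zero_le_two]
  norm_num

theorem H2_conjTranspose : H2ᴴ = H2 := by
  ext i j
  fin_cases i <;> fin_cases j <;> simp [H2]

theorem σx_conjTranspose : σxᴴ = σx := by
  ext i j
  fin_cases i <;> fin_cases j <;> simp [σx]

theorem projL_conjTranspose : projLᴴ = projL := by
  ext i j
  fin_cases i <;> fin_cases j <;> simp [projL]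

theorem projR_conjTranspose : projRᴴ = projR := by
  ext i j
  fin_cases i <;> fin_cases j <;> simp [projR]

theorem H2_mul_mul_H2 (a b c d : ℂ) :
    H2 * !![a, b; c, d] * H2 =
      (1 / 2 : ℂ) • !![a + b + c + d, a - b + c - d; a + b - c - d, a - b - c + d] := by
  simp only [H2, Matrix.smul_mul, Matrix.mul_smul, smul_smul, one_div, inv_sqrt_two_mul_self]
  congr 1
  ext i j
  fin_cases i <;> fin_cases j <;> simp [Matrix.mul_apply, Fin.sum_univ_two] <;> ring

theorem H2_mul_σx_mul_H2 : H2 * σx * H2 = σz := by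
  rw [σx, H2_mul_mul_H2]
  ext i j
  fin_cases i <;> fin_cases j <;> norm_num [σz]

theorem projL_mul_σy_mul_projL : projL * σy * projL = 0 := by
  ext i j
  fin_cases i <;> fin_cases j <;> simp [projL, σy]

theorem projR_mul_σy_mul_projR : projR * σy * projR = 0 := by
  ext i j
  fin_cases i <;> fin_cases j <;> simp [projR, σy]

theorem projL_mul_σy_mul_projR : projL * σy * projR = !![0, -Complex.I; 0, 0] := by
  ext i j
  fin_cases i <;> fin_cases j <;> simp [projL, projR, σy]

theorem projR_mul_σy_mul_projL : projR * σy * projL = !![0, 0; Complex.I, 0] := by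
  ext i j
  fin_cases i <;> fin_cases j <;> simp [projL, projR, σy]

theorem σy_mul_σx : σy * σx = (-Complex.I) • σz := by
  simp [σx, σy, σz]

theorem σx_mul_σy : σx * σy = Complex.I • σz := by
  simp [σx, σy, σz]

theorem Lmat_add_two (m : ℕ) : Lmat (m + 2) = -kpow σz (m + 2) := by
  have hM : Mmat (m + 2) = kronEnds σy 1 σy := rfl
  have conj (P Q : Matrix (Fin 2) (Fin 2) ℂ) :
      H2 * P * σy * (Q * H2) = H2 * (P * σy * Q) * H2 := by
    simp only [Matrix.mul_assoc]
  rw [Lmat, Bmat_add_two, hM, kpow_add_two, ← kronEnds_neg_left]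
  simp only [Matrix.conjTranspose_add, kronEnds_conjTranspose, kpow_conjTranspose,
    Matrix.conjTranspose_mul, Matrix.conjTranspose_one, H2_conjTranspose, σx_conjTranspose,
    projL_conjTranspose, projR_conjTranspose, add_mul, mul_add, kronEnds_mul, one_mul, mul_one,
    kpow_mul, conj, projL_mul_σy_mul_projL, projR_mul_σy_mul_projR, projL_mul_σy_mul_projR,
    projR_mul_σy_mul_projL, mul_zero, zero_mul, kronEnds_zero_left, zero_add, add_zero,
    ← Matrix.mul_assoc H2 σx H2, H2_mul_σx_mul_H2]
  simp only [σy_mul_σx, σx_mul_σy, kronEnds_smul_right,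
    ← kronEnds_add_left]
  congr 1
  rw [H2_mul_mul_H2, H2_mul_mul_H2]
  ext i j
  fin_cases i <;> fin_cases j <;> simp [σz] <;> ring_nf <;> simp [Complex.I_sq]

theorem kron_neg {a b : ℕ} (A : Matrix (Fin a) (Fin a) ℂ) (B : Matrix (Fin b) (Fin b) ℂ) :
    kron A (-B) = -kron A B := by
  ext i j
  simp [kron]

/-- For all `n ≥ 2`, the matrices `L_{2^n}` satisfy the recursion
`L_{2^{n+1}} = σ_z ⊗ L_{2^n}`. -/
theorem Lmat_recursion (n : ℕ) (hn : 2 ≤ n) :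
    Lmat (n + 1) = matCast (by rw [pow_succ, Nat.mul_comm]) (kron σz (Lmat n)) := by
  obtain ⟨m, rfl⟩ := Nat.exists_eq_add_of_le' hn
  rw [Lmat_add_two m, kron_neg]
  exact Lmat_add_two (m + 1)

end
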